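/- There exist real numbers θ̃₁ and θ̃₂ with 0 < θ̃₁ < 1 < θ̃₂ and θ̃₁·θ̃₂ = 1 such that for every θ > 0: √2·(θ² − 1)²·(1 + θ²) < (1 + θ²)³ + 4θ³ holds if and only if θ̃₁ < θ < θ̃₂. (Hence the disordered phase of the mixed spin-(1,1/2) Ising model on the order-2 Cayley tree is extreme exactly for θ in (θ̃₁, θ̃₂), and by the Kesten–Stigum criterion not extreme for θ in (0, θ̃₁) ∪ (θ̃₂, ∞).) -/

import Mathlib

/-- there exist 0 < θ̃₁ < 1 < θ̃₂ with θ̃₁·θ̃₂ = 1 such that for all θ > 0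
the extremality inequality √2·(θ² − 1)²·(1 + θ²) < (1 + θ²)³ + 4θ³ holds iff
θ̃₁ < θ < θ̃₂. -/
theorem stmt_17 :
    ∃ θ₁ θ₂ : ℝ, 0 < θ₁ ∧ θ₁ < 1 ∧ 1 < θ₂ ∧ θ₁ * θ₂ = 1 ∧
      ∀ θ : ℝ, 0 < θ →
        (Real.sqrt 2 * (θ^2 - 1)^2 * (1 + θ^2) < (1 + θ^2)^3 + 4*θ^3 ↔
          θ₁ < θ ∧ θ < θ₂) := by
  have hs : (1.4 : ℝ) < Real.sqrt 2 := Real.lt_sqrt_of_sq_lt (by norm_num)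
  generalize Real.sqrt 2 = s at *
  have hivt : (0:ℝ) ∈ (fun t : ℝ => s * (t^2 - 1)^2 * (1 + t^2) - (1 + t^2)^3 - 4*t^3) ''
      Set.Ioo 1 5 := by
    apply intermediate_value_Ioo (by norm_num) (by fun_prop)
    constructor
    · norm_num
    · norm_num
      linarith
  obtain ⟨t, ⟨h1, h5⟩, ht⟩ := hivt
  simp only at ht
  have ht0 : 0 < t := by linarith
  obtain ⟨r, hr⟩ : ∃ r, r = t⁻¹ := ⟨_, rfl⟩
  have hrt : r * t = 1 := by rw [hr]; field_simp
  have hr0 : 0 < r := by rw [hr]; positivity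
  have hr1 : r < 1 := by nlinarith
  refine ⟨r, t, hr0, hr1, h1, hrt, fun θ hθ => ?_⟩
  obtain ⟨c, hc⟩ : ∃ c, c = t + r := ⟨_, rfl⟩
  have hc0 : 0 < c := by linarith
  have hg : (s - 1) * c^3 - 4 * s * c - 4 = 0 := by
    have : t^3 * ((s - 1) * c^3 - 4 * s * c - 4) = 0 := by
      rw [← ht, hc, hr]; field_simp; ring
    exact (mul_eq_zero.mp this).resolve_left (by positivity)
  have hq : θ^2 - c*θ + 1 = (θ - r) * (θ - t) := by
    rw [hc]; linear_combination -hrt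
  have key : c * (s * (θ^2 - 1)^2 * (1 + θ^2) - (1 + θ^2)^3 - 4*θ^3) =
      ((θ - r) * (θ - t)) * ((s-1) * (θ^2+1) * c * (θ^2+1+c*θ) + 4*θ^2) := by
    rw [← hq]
    linear_combination (θ^2 * (θ^2+1)) * hg
  have hs1 : 0 < s - 1 := by linarith
  have hP : 0 < (s-1) * (θ^2+1) * c * (θ^2+1+c*θ) + 4*θ^2 := by positivity
  have e : s * (θ^2 - 1)^2 * (1 + θ^2) < (1 + θ^2)^3 + 4*θ^3 ↔ (θ - r) * (θ - t) < 0 := by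
    constructor
    · intro h
      by_contra! h'
      have := mul_nonneg h' hP.le
      rw [← key] at this
      have := nonneg_of_mul_nonneg_right this hc0
      linarith
    · intro h
      have := mul_neg_of_neg_of_pos h hP
      rw [← key] at this
      by_contra! h'
      have := mul_nonneg hc0.le (by linarith : 0 ≤ s * (θ^2 - 1)^2 * (1 + θ^2) - (1 + θ^2)^3 - 4*θ^3)
      linarith
  rw [e, mul_neg_iff]
  constructor
  · rintro (⟨a, b⟩ | ⟨a, b⟩)
    · constructor <;> linarith
    · exfalso; linarith
  · rintro ⟨a, b⟩
    left; constructor <;> linarith
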